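/- arXiv:2003.11801 — 2 statements merged into one kernel-verified Lean document; each statement's English description precedes it below -/
import Mathlib

section
/- Let G be a countable group. If there exists an injective group homomorphism from G into the group of order-preserving bijections of the real line ℝ (under composition), then G is left-orderable. -/
/-- If a countable group `G` admits an injective group homomorphism into the group of
order-preserving bijections of the real line `ℝ`, then `G` is left-orderable: there is a
strict total order on `G` invariant under left multiplication. -/
theorem stmt_0 (G : Type*) [Group G] [Countable G]
    (φ : G →* (ℝ ≃o ℝ)) (hφ : Function.Injective φ) :
    ∃ lt : G → G → Prop, IsStrictTotalOrder G lt ∧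
      ∀ f g h : G, lt g h → lt (f * g) (f * h) := by
  let r : ℝ → ℝ → Prop := WellOrderingRel
  have hwf : WellFounded r := WellOrderingRel.isWellOrder.wf
  have htri : ∀ a b : ℝ, r a b ∨ a = b ∨ r b a := fun a b => trichotomous_of r a b
  have htr : ∀ a b c : ℝ, r a b → r b c → r a c := fun a b c h1 h2 => trans_of r h1 h2
  let lt : G → G → Prop := fun g h =>
    ∃ x, (∀ y, r y x → φ g y = φ h y) ∧ φ g x < φ h x
  have hirr : ∀ a, ¬ lt a a := fun a ⟨x, _, h⟩ => lt_irrefl _ h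
  have htrans : ∀ a b c, lt a b → lt b c → lt a c := by
    rintro a b c ⟨x, hx, hx'⟩ ⟨y, hy, hy'⟩
    rcases htri x y with h | h | h
    · exact ⟨x, fun z hz => (hx z hz).trans (hy z (htr _ _ _ hz h)), (hy x h) ▸ hx'⟩
    · subst h
      exact ⟨x, fun z hz => (hx z hz).trans (hy z hz), hx'.trans hy'⟩
    · exact ⟨y, fun z hz => (hx z (htr _ _ _ hz h)).trans (hy z hz), (hx y h).symm ▸ hy'⟩
  have htot : ∀ a b, lt a b ∨ a = b ∨ lt b a := by
    intro a b
    by_cases hab : a = b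
    · exact Or.inr (Or.inl hab)
    have hne : ({x | φ a x ≠ φ b x} : Set ℝ).Nonempty := by
      by_contra hc
      apply hab
      apply hφ
      ext x
      by_contra hx
      exact hc ⟨x, hx⟩
    obtain ⟨x, hx, hmin⟩ := hwf.has_min _ hne
    have heq : ∀ y, r y x → φ a y = φ b y := fun y hy => by
      by_contra hc
      exact hmin y hc hy
    rcases lt_or_gt_of_ne hx with h | h
    · exact Or.inl ⟨x, heq, h⟩
    · exact Or.inr (Or.inr ⟨x, fun y hy => (heq y hy).symm, h⟩)
  refine ⟨lt, ?_, ?_⟩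
  · exact
      { irrefl := hirr
        trans := htrans
        trichotomous := fun a b h1 h2 => by
          rcases htot a b with h | h | h
          · exact absurd h h1
          · exact h
          · exact absurd h h2 }
  · rintro f g h ⟨x, hx, hx'⟩
    refine ⟨x, fun y hy => ?_, ?_⟩
    · rw [map_mul, map_mul, RelIso.mul_apply, RelIso.mul_apply, hx y hy]
    · rw [map_mul, map_mul, RelIso.mul_apply, RelIso.mul_apply]
      exact (φ f).lt_iff_lt.2 hx'
end

section
/- For all integers p, q ≥ 1, in SL₂(ℤ) one has φ_A^p · φ_B^{-2} · φ_A^q · φ_B = [[-2pq - p + q + 1, -2pq + p + q], [-2q - 1, -2q + 1]]; in particular the trace of this matrix equals 2 - q - p(1 + 2q), and this trace is strictly less than -2 whenever p, q ≥ 2. -/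
/-- The matrix induced by a Dehn twist along the curve `A`. -/
def phiA : Matrix.SpecialLinearGroup (Fin 2) ℤ :=
  ⟨!![1, 1; 0, 1], by norm_num [Matrix.det_fin_two_of]⟩

/-- The matrix induced by a Dehn twist along the curve `B`. -/
def phiB : Matrix.SpecialLinearGroup (Fin 2) ℤ :=
  ⟨!![1, 0; 1, 1], by norm_num [Matrix.det_fin_two_of]⟩

theorem phiA_zpow_coe (n : ℤ) :
    ((phiA ^ n : Matrix.SpecialLinearGroup (Fin 2) ℤ) : Matrix (Fin 2) (Fin 2) ℤ) =
      !![1, n; 0, 1] :=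
  ModularGroup.coe_T_zpow n

theorem phiB_zpow_coe :
    ((phiB ^ (-2 : ℤ) : Matrix.SpecialLinearGroup (Fin 2) ℤ) : Matrix (Fin 2) (Fin 2) ℤ) =
      !![1, 0; -2, 1] := by
  decide

/-- For all integers `p, q ≥ 1`, in `SL₂(ℤ)` one has
`φ_A^p · φ_B^{-2} · φ_A^q · φ_B = [[-2pq - p + q + 1, -2pq + p + q], [-2q - 1, -2q + 1]]`;
its trace is `2 - q - p(1 + 2q)`, which is `< -2` whenever `p, q ≥ 2`. -/
theorem stmt_3 (p q : ℤ) (hp : 1 ≤ p) (hq : 1 ≤ q) :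
    ((phiA ^ p * phiB ^ (-2 : ℤ) * phiA ^ q * phiB :
        Matrix.SpecialLinearGroup (Fin 2) ℤ) : Matrix (Fin 2) (Fin 2) ℤ) =
      !![-2 * p * q - p + q + 1, -2 * p * q + p + q; -2 * q - 1, -2 * q + 1] ∧
    Matrix.trace ((phiA ^ p * phiB ^ (-2 : ℤ) * phiA ^ q * phiB :
        Matrix.SpecialLinearGroup (Fin 2) ℤ) : Matrix (Fin 2) (Fin 2) ℤ) =
      2 - q - p * (1 + 2 * q) ∧
    (2 ≤ p → 2 ≤ q →
      Matrix.trace ((phiA ^ p * phiB ^ (-2 : ℤ) * phiA ^ q * phiB :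
        Matrix.SpecialLinearGroup (Fin 2) ℤ) : Matrix (Fin 2) (Fin 2) ℤ) < -2) := by
  have h : ((phiA ^ p * phiB ^ (-2 : ℤ) * phiA ^ q * phiB :
        Matrix.SpecialLinearGroup (Fin 2) ℤ) : Matrix (Fin 2) (Fin 2) ℤ) =
      !![-2 * p * q - p + q + 1, -2 * p * q + p + q; -2 * q - 1, -2 * q + 1] := by
    have hB : (phiB : Matrix (Fin 2) (Fin 2) ℤ) = !![1, 0; 1, 1] := rfl
    rw [Matrix.SpecialLinearGroup.coe_mul, Matrix.SpecialLinearGroup.coe_mul,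
      Matrix.SpecialLinearGroup.coe_mul, phiA_zpow_coe, phiA_zpow_coe, phiB_zpow_coe, hB]
    ext i j
    fin_cases i <;> fin_cases j <;> simp [Matrix.mul_apply, Fin.sum_univ_two] <;> ring
  refine ⟨h, ?_, ?_⟩
  · rw [h, Matrix.trace_fin_two_of]
    ring
  · intro h2p h2q
    rw [h, Matrix.trace_fin_two_of]
    nlinarith [mul_nonneg (sub_nonneg.2 hp) (sub_nonneg.2 hq)]
end
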